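/- For every n ≥ 3, the dynamical Lie algebra ℒ (the smallest real Lie subalgebra of the 2^n × 2^n complex matrices containing iH0 and iH1) equals the real linear span of the 3n−1 matrices Y^j, Z^j, YZ^j (j = 0,…,n−2), X and XX; in particular ℒ has real dimension 3n−1. -/

import Mathlib

namespace Ising

noncomputable section

open Matrix

/-- We model `2^n × 2^n` complex matrices as matrices indexed by `Fin n → Fin 2`
(the standard index type for an `n`-fold tensor product of qubits). -/
abbrev M (n : ℕ) := Matrix (Fin n → Fin 2) (Fin n → Fin 2) ℂ

/-- The Pauli matrix σx. -/
def sx : Matrix (Fin 2) (Fin 2) ℂ := !![0, 1; 1, 0]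
/-- The Pauli matrix σy. -/
def sy : Matrix (Fin 2) (Fin 2) ℂ := !![0, Complex.I; -Complex.I, 0]
/-- The Pauli matrix σz. -/
def sz : Matrix (Fin 2) (Fin 2) ℂ := !![1, 0; 0, -1]

/-- The `n`-fold Kronecker product of the `2 × 2` matrices `f 0, …, f (n-1)`. -/
def kron {n : ℕ} (f : Fin n → Matrix (Fin 2) (Fin 2) ℂ) : M n :=
  fun x y => ∏ j, f j (x j) (y j)

/-- The matrix `σ` placed in the `j`-th tensor factor, identity elsewhere (`σ^j`). -/
def pauliAt (n : ℕ) (σ : Matrix (Fin 2) (Fin 2) ℂ) (j : Fin n) : M n :=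
  kron fun i => if i = j then σ else 1

/-- The permutation matrix implementing the cyclic shift of the `n` tensor factors. -/
def P (n : ℕ) : M n :=
  fun x y => if x = (fun i => y (finRotate n i)) then 1 else 0

/-- The symmetrizer `C(A) = ∑_{k=0}^{n-1} Pᵏ A (Pᵏ)⁻¹` over the cyclic group `C_n`. -/
def symmC {n : ℕ} (A : M n) : M n :=
  ∑ k ∈ Finset.range n, P n ^ k * A * (P n ^ k)⁻¹

/-- The Pauli string `a ⊗ σx^{⊗j} ⊗ b ⊗ 1^{⊗(n-j-2)}`. -/
def str (n : ℕ) (a b : Matrix (Fin 2) (Fin 2) ℂ) (j : ℕ) : M n :=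
  kron fun i => if (i : ℕ) = 0 then a else if (i : ℕ) = j + 1 then b
    else if (i : ℕ) ≤ j then sx else 1

/-- `Y^j := i C(σy ⊗ σx^{⊗j} ⊗ σy ⊗ 1^{⊗(n-j-2)})`. -/
def Y (n j : ℕ) : M n := Complex.I • symmC (str n sy sy j)
/-- `Z^j := i C(σz ⊗ σx^{⊗j} ⊗ σz ⊗ 1^{⊗(n-j-2)})`. -/
def Z (n j : ℕ) : M n := Complex.I • symmC (str n sz sz j)
/-- `YZ^j := i C(σz ⊗ σx^{⊗j} ⊗ σy ⊗ 1^{⊗(n-j-2)}) + i C(σy ⊗ σx^{⊗j} ⊗ σz ⊗ 1^{⊗(n-j-2)})`. -/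
def YZ (n j : ℕ) : M n :=
  Complex.I • symmC (str n sz sy j) + Complex.I • symmC (str n sy sz j)
/-- `X := i C(σx ⊗ 1^{⊗(n-1)})`. -/
def X (n : ℕ) : M n :=
  Complex.I • symmC (kron fun i : Fin n => if (i : ℕ) = 0 then sx else 1)
/-- `XX := i C(σx^{⊗(n-1)} ⊗ 1)`. -/
def XX (n : ℕ) : M n :=
  Complex.I • symmC (kron fun i : Fin n => if (i : ℕ) = n - 1 then 1 else sx)

/-- `H0 = ∑_{j=1}^{n-1} σz^j σz^{j+1} + σz^n σz^1` (cyclically next neighbours). -/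
def H0 (n : ℕ) : M n := ∑ j : Fin n, pauliAt n sz j * pauliAt n sz (finRotate n j)
/-- `H1 = ∑_{j=1}^{n} σx^j`. -/
def H1 (n : ℕ) : M n := ∑ j : Fin n, pauliAt n sx j

attribute [local instance 100] LieRing.ofAssociativeRing

/-- The dynamical Lie algebra: the smallest real Lie subalgebra of the `2^n × 2^n`
complex matrices (with the commutator bracket) containing `i•H0` and `i•H1`. -/
def DLA (n : ℕ) : LieSubalgebra ℝ (M n) :=
  LieSubalgebra.lieSpan ℝ (M n) {Complex.I • H0 n, Complex.I • H1 n}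


/-! ### Abstract cyclic generators -/

structure Cyc {R : Type*} [Ring R] (n : ℕ) (E : ℤ → R) : Prop where
  per : ∀ q, E (q + 2 * n) = E q
  sq : ∀ q, E q * E q = -1
  anti : ∀ q, E q * E (q + 1) = -(E (q + 1) * E q)
  comm : ∀ q r : ℤ, 2 ≤ r - q → r - q ≤ 2 * n - 2 → Commute (E q) (E r)

def TT {R : Type*} [Ring R] (E : ℤ → R) (p : ℤ) : ℕ → R
  | 0 => 1
  | l + 1 => TT E p l * E (p + l)

def SS {R : Type*} [Ring R] (n : ℕ) (E : ℤ → R) (p : ℤ) (l : ℕ) : R :=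
  ∑ k ∈ Finset.range n, TT E (p + 2 * k) l

def br {R : Type*} [Ring R] (x y : R) : R := x * y - y * x

section abstractpart
variable {R : Type*} [Ring R] {n : ℕ} {E : ℤ → R}

lemma TT_add (p : ℤ) (a b : ℕ) : TT E p (a + b) = TT E p a * TT E (p + a) b := by
  induction b with
  | zero => simp [TT]
  | succ b ih =>
    rw [← add_assoc, TT, ih, TT, mul_assoc]; congr 3; push_cast; ring

lemma TT_one (p : ℤ) : TT E p 1 = E p := by simp [TT]

lemma TT_left (p : ℤ) (l : ℕ) : TT E p (l + 1) = E p * TT E (p + 1) l := by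
  rw [add_comm, TT_add, TT_one]; simp

lemma comm_TT (x : R) (p : ℤ) (l : ℕ) (h : ∀ i : ℕ, i < l → Commute x (E (p + i))) :
    Commute x (TT E p l) := by
  induction l with
  | zero => simp [TT]
  | succ l ih =>
    rw [TT]
    exact (ih fun i hi => h i (by omega)).mul_right (h l (by omega))

namespace Cyc

lemma comm_out (h : Cyc n E) (p : ℤ) (l s : ℕ) (h1 : l + 1 ≤ s) (h2 : s + 2 ≤ 2 * n) :
    Commute (E (p + s)) (TT E p l) := by
  apply comm_TT
  intro i hi
  exact (h.comm _ _ (by omega) (by omega)).symm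

lemma comm_low (h : Cyc n E) (p q : ℤ) (l : ℕ) (h1 : 2 ≤ p - q) (h2 : p - q + l + 1 ≤ 2 * n) :
    Commute (E q) (TT E p l) := by
  apply comm_TT
  intro i hi
  exact (h.comm _ _ (by omega) (by omega))

lemma comm_in (h : Cyc n E) (p : ℤ) (l s : ℕ) (h0 : 1 ≤ s) (h1 : s + 2 ≤ l) (h2 : l + 1 ≤ 2 * n) :
    Commute (E (p + s)) (TT E p l) := by
  obtain ⟨s, rfl⟩ : ∃ t, s = t + 1 := ⟨s - 1, by omega⟩
  obtain ⟨r, rfl⟩ : ∃ t, l = s + (3 + t) := ⟨l - s - 3, by omega⟩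
  rw [TT_add, TT_add]
  refine (h.comm_out p s (s+1) (by omega) (by omega)).mul_right (Commute.mul_right ?_ ?_)
  · have e : TT E (p + s) 3 = E (p+s) * E (p + s + 1) * E (p + s + 1 + 1) := by
      simp [TT]; congr 2; ring
    rw [e]
    have a1 := h.anti (p+s)
    have a2 := h.anti (p+s+1)
    have e2 : p + ((s+1 : ℕ):ℤ) = p + s + 1 := by push_cast; ring
    rw [e2]
    generalize E (p+s+1+1) = z at *
    generalize E (p+s+1) = y at *
    generalize E (p+s) = x at *
    show y * (x * y * z) = x * y * z * y
    have a1' : y * x = -(x * y) := by rw [a1, neg_neg]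
    have a2' : z * y = -(y * z) := by rw [a2, neg_neg]
    rw [mul_assoc (x*y), a2']
    rw [← mul_assoc, ← mul_assoc, a1']; simp [mul_assoc]
  · apply h.comm_low <;> push_cast <;> omega

lemma antiL (h : Cyc n E) (p : ℤ) (l : ℕ) (h1 : l + 3 ≤ 2 * n) :
    E p * TT E (p+1) (l+1) = -(TT E (p+1) (l+1) * E p) := by
  rw [TT_left]
  have := h.comm_low (p+1+1) p l (by omega) (by omega)
  rw [← mul_assoc, h.anti, mul_assoc (E (p+1)), ← this.eq]; simp [mul_assoc]

lemma antiR (h : Cyc n E) (p : ℤ) (l : ℕ) (h1 : l + 3 ≤ 2 * n) :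
    E (p+l+1) * TT E p (l+1) = -(TT E p (l+1) * E (p+l+1)) := by
  rw [TT]
  have := h.comm_out p l (l+1) (by omega) (by omega)
  have e2 : p + ((l+1 : ℕ):ℤ) = p + l + 1 := by push_cast; ring
  rw [e2] at this
  rw [← mul_assoc, this.eq, mul_assoc, mul_assoc, h.anti (p+l)]; simp

lemma wrap (h : Cyc n E) (p : ℤ) (m : ℕ) (hm : 2 * m + 1 + 1 = 2 * n) (hm1 : 1 ≤ m) :
    Commute (E (p-1)) (TT E p (2*m+1)) := by
  obtain ⟨m, rfl⟩ : ∃ t, m = t + 1 := ⟨m - 1, by omega⟩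
  rw [TT, show 2 * (m+1) = (2*m+1)+1 by ring, TT_left]
  have a := h.anti (p-1)
  rw [sub_add_cancel] at a
  have b := h.comm_low (p+1) (p-1) (2*m+1) (by omega) (by push_cast; omega)
  have c := h.anti (p + ((2*m+1+1:ℕ):ℤ))
  have d : E (p + ((2*m+1+1:ℕ):ℤ) + 1) = E (p-1) := by
    rw [← h.per (p-1)]; congr 1; push_cast; omega
  rw [d] at c
  generalize E (p + ((2*m+1+1:ℕ):ℤ)) = z at *
  generalize E (p-1) = x at *
  generalize TT E (p+1) (2*m+1) = t at *
  generalize E p = y at *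
  show x * (y * t * z) = y * t * z * x
  rw [mul_assoc (y*t), c, mul_neg, ← mul_assoc (y*t), mul_assoc y t x, ← b.eq]
  rw [← mul_assoc x, ← mul_assoc x, a]; simp [mul_assoc]

lemma br_inL (h : Cyc n E) (p : ℤ) (l : ℕ) (h1 : l + 3 ≤ 2 * n) :
    br (E p) (TT E p (l+2)) = -2 * TT E (p+1) (l+1) := by
  rw [br, show l + 2 = (l+1)+1 by ring, TT_left]
  have := h.antiL p l h1
  have this' : TT E (p+1) (l+1) * E p = -(E p * TT E (p+1) (l+1)) := by rw [this, neg_neg]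
  rw [mul_assoc, this', mul_neg, ← mul_assoc, h.sq]; noncomm_ring

lemma br_inR (h : Cyc n E) (p : ℤ) (l : ℕ) (h1 : l + 3 ≤ 2 * n) :
    br (E (p+l+1)) (TT E p (l+2)) = 2 * TT E p (l+1) := by
  rw [br, show l + 2 = (l+1)+1 by ring, TT]
  have := h.antiR p l h1
  have e2 : p + ((l+1 : ℕ):ℤ) = p + l + 1 := by push_cast; ring
  rw [e2, ← mul_assoc, this, neg_mul, mul_assoc, h.sq]; noncomm_ring

lemma br_outL (h : Cyc n E) (p : ℤ) (l : ℕ) (h1 : l + 3 ≤ 2 * n) :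
    br (E (p-1)) (TT E p (l+1)) = 2 * TT E (p-1) (l+2) := by
  have := h.antiL (p-1) l h1
  rw [sub_add_cancel] at this
  rw [br, show l + 2 = (l+1)+1 by ring, TT_left (p-1), sub_add_cancel]
  have this' : TT E p (l+1) * E (p-1) = -(E (p-1) * TT E p (l+1)) := by rw [this, neg_neg]
  rw [this']; noncomm_ring

lemma br_outR (h : Cyc n E) (p : ℤ) (l : ℕ) (h1 : l + 3 ≤ 2 * n) :
    br (E (p+l+1)) (TT E p (l+1)) = -2 * TT E p (l+2) := by
  have := h.antiR p l h1
  have e2 : p + ((l+1 : ℕ):ℤ) = p + l + 1 := by push_cast; ring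
  rw [br, show l + 2 = (l+1)+1 by ring, TT.eq_2 E p (l+1), e2, this]; noncomm_ring

lemma br_comm {x y : R} (hc : Commute x y) : br x y = 0 := by rw [br, hc.eq, sub_self]

lemma br_zero (h : Cyc n E) (p : ℤ) (l s : ℕ) (hl : l + 1 ≤ 2 * n)
    (hs : (1 ≤ s ∧ s + 2 ≤ l) ∨ (l + 1 ≤ s ∧ s + 2 ≤ 2 * n)) :
    br (E (p+s)) (TT E p l) = 0 := by
  apply br_comm
  rcases hs with hs | hs
  · exact h.comm_in p l s hs.1 hs.2 hl
  · exact h.comm_out p l s hs.1 hs.2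

lemma L1 (h : Cyc n E) (p : ℤ) (m : ℕ) (hm : m + 1 ≤ n) :
    ∑ k ∈ Finset.range n, br (E (p + 2 * k)) (TT E p (2*m+1))
      = 2 * (TT E p (2*m) - TT E (p+1) (2*m)) := by
  rcases m with _ | m
  · simp only [TT, mul_zero, sub_self]
    apply Finset.sum_eq_zero
    intro k hk
    rw [Finset.mem_range] at hk
    rcases k with _ | k
    · simp [br]
    · have := h.br_zero p 1 (2*(k+1)) (by omega) (by omega)
      simpa [TT] using this
  · rw [Finset.sum_eq_add_of_mem 0 (m+1) (by simp; omega) (by simp; omega) (by omega)]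
    · have a := h.br_inL p (2*m+1) (by omega)
      have b := h.br_inR p (2*m+1) (by omega)
      have e : p + ((2*m+1:ℕ):ℤ) + 1 = p + 2 * ((m+1:ℕ):ℤ) := by push_cast; ring
      rw [e] at b
      rw [show 2 * (m+1) + 1 = 2*m+1+2 by ring, b]
      simp only [Nat.cast_zero, mul_zero, add_zero]
      rw [a, show 2 * (m+1) = 2*m+1+1 by ring]; noncomm_ring
    · intro k hk hk2
      rw [Finset.mem_range] at hk
      have := h.br_zero p (2*(m+1)+1) (2*k) (by omega) (by omega)
      push_cast at this ⊢; exact this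

lemma L2 (h : Cyc n E) (p : ℤ) (m : ℕ) (hm : m + 2 ≤ n) :
    ∑ k ∈ Finset.range n, br (E (p + 1 + 2 * k)) (TT E p (2*m+1))
      = 2 * (TT E (p-1) (2*m+2) - TT E p (2*m+2)) := by
  rw [Finset.sum_eq_add_of_mem (n-1) m (by simp; omega) (by simp; omega) (by omega)]
  · have a := h.br_outL p (2*m) (by omega)
    have b := h.br_outR p (2*m) (by omega)
    have e : p + ((2*m:ℕ):ℤ) + 1 = p + 1 + 2 * ((m:ℕ):ℤ) := by push_cast; ring
    have e2 : E (p + 1 + 2 * ((n-1:ℕ):ℤ)) = E (p - 1) := by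
      rw [← h.per (p-1)]; congr 1; omega
    rw [e] at b
    rw [b, e2, a]; noncomm_ring
  · intro k hk hk2
    rw [Finset.mem_range] at hk
    have := h.br_zero p (2*m+1) (2*k+1) (by omega) (by omega)
    push_cast at this
    rw [show p + 1 + 2 * (k:ℤ) = p + (2 * k + 1) by ring]; exact this

lemma L2' (h : Cyc n E) (p : ℤ) (m : ℕ) (hm : m + 1 = n) (hm1 : 1 ≤ m) :
    ∑ k ∈ Finset.range n, br (E (p + 1 + 2 * k)) (TT E p (2*m+1)) = 0 := by
  apply Finset.sum_eq_zero
  intro k hk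
  rw [Finset.mem_range] at hk
  by_cases hkm : k = m
  · have e2 : E (p + 1 + 2 * (k:ℤ)) = E (p - 1) := by
      rw [← h.per (p-1)]; congr 1; omega
    rw [e2]
    exact br_comm (h.wrap p m (by omega) hm1)
  · have := h.br_zero p (2*m+1) (2*k+1) (by omega) (by omega)
    push_cast at this
    rw [show p + 1 + 2 * (k:ℤ) = p + (2 * k + 1) by ring]; exact this

lemma L3 (h : Cyc n E) (p : ℤ) (m : ℕ) (hm : m + 2 ≤ n) :
    ∑ k ∈ Finset.range n, br (E (p + 2 * k)) (TT E p (2*m+2))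
      = -2 * (TT E (p+1) (2*m+1) + TT E p (2*m+3)) := by
  rw [Finset.sum_eq_add_of_mem 0 (m+1) (by simp; omega) (by simp; omega) (by omega)]
  · have a := h.br_inL p (2*m) (by omega)
    have b := h.br_outR p (2*m+1) (by omega)
    have e : p + ((2*m+1:ℕ):ℤ) + 1 = p + 2 * ((m+1:ℕ):ℤ) := by push_cast; ring
    rw [e] at b
    rw [show 2*m+2 = 2*m+1+1 by ring, b]
    simp only [Nat.cast_zero, mul_zero, add_zero]
    rw [show 2*m+1+1 = 2*m+2 by ring, a]; noncomm_ring
  · intro k hk hk2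
    rw [Finset.mem_range] at hk
    have := h.br_zero p (2*m+2) (2*k) (by omega) (by omega)
    push_cast at this ⊢; exact this

lemma L4 (h : Cyc n E) (p : ℤ) (m : ℕ) (hm : m + 2 ≤ n) :
    ∑ k ∈ Finset.range n, br (E (p + 1 + 2 * k)) (TT E p (2*m+2))
      = 2 * (TT E p (2*m+1) + TT E (p-1) (2*m+3)) := by
  rw [Finset.sum_eq_add_of_mem m (n-1) (by simp; omega) (by simp; omega) (by omega)]
  · have a := h.br_inR p (2*m) (by omega)
    have b := h.br_outL p (2*m+1) (by omega)
    have e : p + ((2*m:ℕ):ℤ) + 1 = p + 1 + 2 * ((m:ℕ):ℤ) := by push_cast; ring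
    have e2 : E (p + 1 + 2 * ((n-1:ℕ):ℤ)) = E (p - 1) := by
      rw [← h.per (p-1)]; congr 1; omega
    rw [e] at a
    rw [a, e2, show 2*m+2 = 2*m+1+1 by ring, b]; noncomm_ring
  · intro k hk hk2
    rw [Finset.mem_range] at hk
    have := h.br_zero p (2*m+2) (2*k+1) (by omega) (by omega)
    push_cast at this
    rw [show p + 1 + 2 * (k:ℤ) = p + (2 * k + 1) by ring]; exact this

lemma TT_per (h : Cyc n E) (p : ℤ) (l : ℕ) : TT E (p + 2 * n) l = TT E p l := by
  induction l with
  | zero => simp [TT]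
  | succ l ih => rw [TT, TT, ih, ← h.per (p + l)]; congr 2; ring

lemma SS_per (h : Cyc n E) (p : ℤ) (l : ℕ) : SS n E (p + 2) l = SS n E p l := by
  have h1 := Finset.sum_range_succ (fun k : ℕ => TT E (p + 2 * k) l) n
  have h2 := Finset.sum_range_succ' (fun k : ℕ => TT E (p + 2 * k) l) n
  rw [h.TT_per] at h1
  rw [h1] at h2
  simp only [Nat.cast_zero, mul_zero, add_zero] at h2
  have := add_right_cancel h2
  rw [SS, SS, this]
  apply Finset.sum_congr rfl
  intro k _; congr 1; push_cast; ring

lemma SS_per_nat (h : Cyc n E) (p : ℤ) (l k : ℕ) : SS n E (p + 2 * k) l = SS n E p l := by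
  induction k with
  | zero => simp
  | succ k ih => rw [← ih, ← h.SS_per (p + 2*k)]; congr 1; push_cast; ring

lemma SS_neg (h : Cyc n E) (l : ℕ) : SS n E (-1) l = SS n E 1 l := by
  rw [← h.SS_per (-1)]; rfl

/-- reduction of the bracket of sums to a sum of local brackets -/
lemma br_SS (h : Cyc n E) (r p : ℤ) (l : ℕ) :
    br (SS n E (p + r) 1) (SS n E p l) = ∑ j ∈ Finset.range n,
      ∑ k ∈ Finset.range n, br (E ((p + 2 * j) + r + 2 * k)) (TT E (p + 2 * j) l) := by
  have key : ∀ j : ℕ, ∑ k ∈ Finset.range n, br (E ((p + 2 * j) + r + 2 * k)) (TT E (p + 2 * j) l)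
      = br (SS n E (p + r) 1) (TT E (p + 2 * j) l) := by
    intro j
    rw [← h.SS_per_nat (p+r) 1 j]
    simp only [SS, br, TT_one, Finset.sum_mul, Finset.mul_sum, ← Finset.sum_sub_distrib]
    apply Finset.sum_congr rfl
    intro k _
    rw [show p + r + 2 * (j:ℤ) + 2 * k = p + 2 * j + r + 2 * k by ring]
  simp only [key]
  generalize SS n E (p + r) 1 = x
  simp only [SS, br, Finset.sum_mul, Finset.mul_sum, ← Finset.sum_sub_distrib]

lemma SS_shift (c p : ℤ) (l : ℕ) :
    ∑ j ∈ Finset.range n, TT E (p + 2 * j + c) l = SS n E (p + c) l := by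
  apply Finset.sum_congr rfl
  intro j _; congr 1; ring

lemma B1 (h : Cyc n E) (p : ℤ) (m : ℕ) (hm : m + 1 ≤ n) :
    br (SS n E p 1) (SS n E p (2*m+1)) = 2 * (SS n E p (2*m) - SS n E (p+1) (2*m)) := by
  have := h.br_SS 0 p (2*m+1)
  simp only [add_zero] at this
  rw [this, Finset.sum_congr rfl fun (j : ℕ) _ => h.L1 (p+2*j) m hm, ← Finset.mul_sum,
    Finset.sum_sub_distrib, SS_shift]; rfl

lemma B2 (h : Cyc n E) (p : ℤ) (m : ℕ) (hm : m + 2 ≤ n) :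
    br (SS n E (p+1) 1) (SS n E p (2*m+1)) = 2 * (SS n E (p+1) (2*m+2) - SS n E p (2*m+2)) := by
  rw [h.br_SS 1 p (2*m+1), Finset.sum_congr rfl fun (j : ℕ) _ => h.L2 (p+2*j) m hm, ← Finset.mul_sum,
    Finset.sum_sub_distrib]
  simp only [sub_eq_add_neg (_ : ℤ) 1]
  rw [SS_shift, ← h.SS_per (p + -1), show p + -1 + 2 = p + 1 by ring]; rfl

lemma B2' (h : Cyc n E) (p : ℤ) (m : ℕ) (hm : m + 1 = n) (hm1 : 1 ≤ m) :
    br (SS n E (p+1) 1) (SS n E p (2*m+1)) = 0 := by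
  rw [h.br_SS 1 p (2*m+1), Finset.sum_congr rfl fun (j : ℕ) _ => h.L2' (p+2*j) m hm hm1]; simp

lemma B3 (h : Cyc n E) (p : ℤ) (m : ℕ) (hm : m + 2 ≤ n) :
    br (SS n E p 1) (SS n E p (2*m+2)) = -2 * (SS n E (p+1) (2*m+1) + SS n E p (2*m+3)) := by
  have := h.br_SS 0 p (2*m+2)
  simp only [add_zero] at this
  rw [this, Finset.sum_congr rfl fun (j : ℕ) _ => h.L3 (p+2*j) m hm, ← Finset.mul_sum,
    Finset.sum_add_distrib, SS_shift]; rfl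

lemma B4 (h : Cyc n E) (p : ℤ) (m : ℕ) (hm : m + 2 ≤ n) :
    br (SS n E (p+1) 1) (SS n E p (2*m+2)) = 2 * (SS n E p (2*m+1) + SS n E (p+1) (2*m+3)) := by
  rw [h.br_SS 1 p (2*m+2), Finset.sum_congr rfl fun (j : ℕ) _ => h.L4 (p+2*j) m hm, ← Finset.mul_sum,
    Finset.sum_add_distrib]
  simp only [sub_eq_add_neg (_ : ℤ) 1]
  rw [SS_shift, ← h.SS_per (p + -1), show p + -1 + 2 = p + 1 by ring]; rfl

end Cyc
end abstractpart

/-! ### Concrete generators -/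

lemma kron_mul {n : ℕ} (f g : Fin n → Matrix (Fin 2) (Fin 2) ℂ) :
    kron f * kron g = kron (fun i => f i * g i) := by
  ext x y
  simp only [kron, Matrix.mul_apply, Finset.prod_univ_sum, Fintype.piFinset_univ,
    Finset.prod_mul_distrib]

lemma kron_one {n : ℕ} : kron (fun _ : Fin n => (1 : Matrix (Fin 2) (Fin 2) ℂ)) = 1 := by
  ext x y
  simp only [kron, Matrix.one_apply, Finset.prod_ite_zero, Finset.prod_const_one, Finset.mem_univ,
    forall_true_left, funext_iff]

lemma kron_smul {n : ℕ} (c : Fin n → ℂ) (f : Fin n → Matrix (Fin 2) (Fin 2) ℂ) :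
    kron (fun i => c i • f i) = (∏ i, c i) • kron f := by
  ext x y
  simp [kron, Finset.prod_mul_distrib]

lemma kron_scale {n : ℕ} (c : ℂ) (j : Fin n) (f g : Fin n → Matrix (Fin 2) (Fin 2) ℂ)
    (h : ∀ i, f i = (if i = j then c else 1) • g i) : kron f = c • kron g := by
  rw [funext h, kron_smul]; simp

lemma sx_sx : sx * sx = 1 := by
  ext i j; fin_cases i <;> fin_cases j <;> simp [sx]
lemma sz_sz : sz * sz = 1 := by
  ext i j; fin_cases i <;> fin_cases j <;> simp [sz]
lemma sx_sz : sx * sz = Complex.I • sy := by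
  ext i j; fin_cases i <;> fin_cases j <;> simp [sx, sz, sy]
lemma sz_sx : sz * sx = (-Complex.I) • sy := by
  ext i j; fin_cases i <;> fin_cases j <;> simp [sx, sz, sy]
lemma sy_sz : sy * sz = (-Complex.I) • sx := by
  ext i j; fin_cases i <;> fin_cases j <;> simp [sx, sz, sy]

lemma pauliAt_same {n : ℕ} (a b : Matrix (Fin 2) (Fin 2) ℂ) (j : Fin n) :
    pauliAt n a j * pauliAt n b j = pauliAt n (a * b) j := by
  rw [pauliAt, pauliAt, kron_mul, pauliAt]; congr 1; ext1 i; split_ifs <;> simp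

lemma pauliAt_one {n : ℕ} (j : Fin n) : pauliAt n 1 j = 1 := by
  simp [pauliAt, kron_one]

lemma pauliAt_smul {n : ℕ} (c : ℂ) (a : Matrix (Fin 2) (Fin 2) ℂ) (j : Fin n) :
    pauliAt n (c • a) j = c • pauliAt n a j := by
  apply kron_scale c j
  intro i; split_ifs <;> simp

lemma pauliAt_comm {n : ℕ} (a b : Matrix (Fin 2) (Fin 2) ℂ) {i j : Fin n} (h : i ≠ j) :
    Commute (pauliAt n a i) (pauliAt n b j) := by
  show _ * _ = _ * _
  rw [pauliAt, pauliAt, kron_mul, kron_mul]; congr 1; ext1 k; split_ifs <;> simp_all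

lemma pauliAt_comm_self {n : ℕ} (a : Matrix (Fin 2) (Fin 2) ℂ) (i j : Fin n) :
    Commute (pauliAt n a i) (pauliAt n a j) := by
  by_cases h : i = j
  · rw [h]
  · exact pauliAt_comm a a h

lemma pauliAt_sq {n : ℕ} {a : Matrix (Fin 2) (Fin 2) ℂ} (h : a * a = 1) (j : Fin n) :
    pauliAt n a j * pauliAt n a j = 1 := by rw [pauliAt_same, h, pauliAt_one]

lemma pauliAt_xz {n : ℕ} (j : Fin n) :
    pauliAt n sx j * pauliAt n sz j = -(pauliAt n sz j * pauliAt n sx j) := by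
  rw [pauliAt_same, pauliAt_same, sx_sz, sz_sx, pauliAt_smul, pauliAt_smul]; simp

def xs {n : ℕ} (j : Fin n) : M n := Complex.I • pauliAt n sx j
def zs {n : ℕ} (j : Fin n) : M n :=
  Complex.I • (pauliAt n sz j * pauliAt n sz (finRotate n j))

lemma I_sq {n : ℕ} {A : M n} (h : A * A = 1) : (Complex.I • A) * (Complex.I • A) = -1 := by
  rw [smul_mul_smul_comm, h, Complex.I_mul_I]; simp

lemma xs_sq {n : ℕ} (j : Fin n) : xs j * xs j = -1 := I_sq (pauliAt_sq sx_sx j)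

lemma zs_sq {n : ℕ} (j : Fin n) : zs j * zs j = -1 := by
  apply I_sq
  have h := pauliAt_comm_self (n := n) sz j (finRotate n j)
  rw [mul_assoc, ← mul_assoc (pauliAt n sz (finRotate n j)), ← h.eq, mul_assoc (pauliAt n sz j),
    pauliAt_sq sz_sz, mul_one, pauliAt_sq sz_sz]

lemma xs_comm {n : ℕ} (i j : Fin n) : Commute (xs i) (xs j) :=
  ((pauliAt_comm_self sx i j).smul_left _).smul_right _

lemma zs_comm {n : ℕ} (i j : Fin n) : Commute (zs i) (zs j) := by
  refine Commute.smul_left (Commute.smul_right ?_ _) _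
  exact ((pauliAt_comm_self sz _ _).mul_right (pauliAt_comm_self sz _ _)).mul_left
    ((pauliAt_comm_self sz _ _).mul_right (pauliAt_comm_self sz _ _))

lemma xs_zs_comm {n : ℕ} {i j : Fin n} (h1 : i ≠ j) (h2 : i ≠ finRotate n j) :
    Commute (xs i) (zs j) := by
  refine Commute.smul_left (Commute.smul_right ?_ _) _
  exact (pauliAt_comm _ _ h1).mul_right (pauliAt_comm _ _ h2)

lemma xs_zs_anti {n : ℕ} {i j : Fin n} (h : i = j ∨ i = finRotate n j) (hj : j ≠ finRotate n j) :
    xs i * zs j = -(zs j * xs i) := by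
  rw [xs, zs, smul_mul_smul_comm, smul_mul_smul_comm, ← smul_neg]
  congr 1
  rcases h with rfl | rfl
  · rw [← mul_assoc, pauliAt_xz, mul_assoc _ _ (pauliAt n sx i),
      ← (pauliAt_comm sx sz hj).eq]; simp [mul_assoc]
  · rw [← mul_assoc, (pauliAt_comm sx sz hj.symm).eq, mul_assoc, pauliAt_xz]; simp [mul_assoc]

def site (N : ℕ) (j : ℤ) : Fin (N + 1) := (j : ZMod (N + 1))

lemma site_eq (N : ℕ) (j k : ℤ) : site N j = site N k ↔ ((N + 1 : ℕ) : ℤ) ∣ k - j :=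
  ZMod.intCast_eq_intCast_iff_dvd_sub j k (N + 1)

lemma rot_site (N : ℕ) (j : ℤ) : finRotate (N + 1) (site N j) = site N (j + 1) := by
  rw [finRotate_apply]
  show ((j : ZMod (N + 1)) + 1 : ZMod (N + 1)) = ((j + 1 : ℤ) : ZMod (N + 1))
  push_cast; rfl

lemma site_val (N : ℕ) (j : ℕ) (h : j < N + 1) : site N j = ⟨j, h⟩ := by
  apply Fin.ext
  show ZMod.val (((j : ℤ) : ZMod (N + 1))) = j
  rw [Int.cast_natCast, ZMod.val_cast_of_lt h]

def EE (N : ℕ) (q : ℤ) : M (N + 1) :=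
  if q % 2 = 0 then xs (site N (q / 2)) else zs (site N (q / 2))

lemma EE_even (N : ℕ) (j : ℤ) : EE N (2 * j) = xs (site N j) := by
  rw [EE, if_pos (by omega)]; congr 2; omega

lemma EE_odd (N : ℕ) (j : ℤ) : EE N (2 * j + 1) = zs (site N j) := by
  rw [EE, if_neg (by omega)]; congr 2; omega

lemma not_dvd_of {n d : ℤ} (h1 : 1 ≤ d) (h2 : d < n) : ¬ n ∣ d := fun h => by
  have := Int.le_of_dvd (by omega) h; omega

lemma not_dvd_of' {n d : ℤ} (h1 : 1 ≤ -d) (h2 : -d < n) : ¬ n ∣ d := fun h => by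
  exact not_dvd_of h1 h2 ((dvd_neg).2 h)

lemma cyc (N : ℕ) (hN : 2 ≤ N) : Cyc (N + 1) (EE N) where
  per q := by
    have h : site N ((q + 2 * ((N + 1 : ℕ) : ℤ)) / 2) = site N (q / 2) := by
      rw [site_eq]
      refine ⟨-1, ?_⟩
      omega
    rw [EE, EE, h]
    congr 1
    apply propext; omega
  sq q := by
    rw [EE]; split_ifs
    · exact xs_sq _
    · exact zs_sq _
  anti q := by
    have hne : ∀ j : ℤ, site N j ≠ finRotate (N + 1) (site N j) := by
      intro j h
      rw [rot_site, site_eq] at h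
      exact not_dvd_of (by omega) (by omega) h
    rcases Int.even_or_odd' q with ⟨j, rfl | rfl⟩
    · rw [EE_odd, EE_even]
      exact xs_zs_anti (Or.inl rfl) (hne j)
    · rw [EE_odd, show 2 * j + 1 + 1 = 2 * (j + 1) by ring, EE_even]
      rw [xs_zs_anti (Or.inr (rot_site N j).symm) (hne j), neg_neg]
  comm q r h1 h2 := by
    rcases Int.even_or_odd' q with ⟨j, rfl | rfl⟩ <;> rcases Int.even_or_odd' r with ⟨k, rfl | rfl⟩
    · rw [EE_even, EE_even]; exact xs_comm _ _
    · rw [EE_even, EE_odd]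
      apply xs_zs_comm
      · rw [Ne, site_eq]; exact not_dvd_of (by omega) (by omega)
      · rw [Ne, rot_site, site_eq]; exact not_dvd_of (by omega) (by omega)
    · rw [EE_even, EE_odd]
      apply Commute.symm
      apply xs_zs_comm
      · rw [Ne, site_eq]; exact not_dvd_of' (by omega) (by omega)
      · rw [Ne, rot_site, site_eq]; exact not_dvd_of' (by omega) (by omega)
    · rw [EE_odd, EE_odd]; exact zs_comm _ _

/-! ### The shift -/

lemma rot_flip {n : ℕ} (x w : Fin n → Fin 2) : (x = fun i => w (finRotate n i)) ↔
    w = fun i => x ((finRotate n).symm i) := by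
  constructor
  · rintro rfl; simp only [Equiv.apply_symm_apply]
  · rintro rfl; simp only [Equiv.symm_apply_apply]

lemma P_kron {n : ℕ} (f : Fin n → Matrix (Fin 2) (Fin 2) ℂ) :
    P n * kron f = kron (fun i => f (finRotate n i)) * P n := by
  ext x y
  simp only [Matrix.mul_apply, P, mul_ite, ite_mul, mul_one, one_mul, mul_zero, zero_mul]
  rw [Finset.sum_ite_eq' Finset.univ (fun i => y (finRotate n i))]
  simp only [rot_flip x, Finset.sum_ite_eq', Finset.mem_univ, if_true]
  simp only [kron]
  rw [← Equiv.prod_comp (finRotate n)]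
  simp only [Equiv.symm_apply_apply]

lemma P_unit (n : ℕ) : IsUnit (P n) := by
  have h : (P n)ᵀ * P n = 1 := by
    ext x y
    simp only [Matrix.mul_apply, P, Matrix.transpose_apply, mul_ite, mul_one, mul_zero,
      Matrix.one_apply]
    rw [Finset.sum_ite_eq' Finset.univ (fun i => y (finRotate n i))]
    simp only [Finset.mem_univ, if_true, funext_iff]
    congr 1
    apply propext
    constructor
    · intro h i
      have := h ((finRotate n).symm i)
      simp only [Equiv.apply_symm_apply] at this
      exact this.symm
    · intro h i; rw [h]
  exact (Matrix.isUnit_iff_isUnit_det _).2 (Matrix.isUnit_det_of_left_inverse h)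

lemma Pk_inv (n k : ℕ) : P n ^ k * (P n ^ k)⁻¹ = 1 :=
  Matrix.mul_nonsing_inv _ ((Matrix.isUnit_iff_isUnit_det _).1 ((P_unit n).pow k))

lemma Pk_kron {n : ℕ} (f : Fin n → Matrix (Fin 2) (Fin 2) ℂ) (k : ℕ) :
    P n ^ k * kron f = kron (fun i => f (((finRotate n) ^ k) i)) * P n ^ k := by
  induction k generalizing f with
  | zero => simp
  | succ k ih =>
    rw [pow_succ, mul_assoc, P_kron, ← mul_assoc, ih, mul_assoc]
    simp [pow_succ']

lemma symmC_kron {n : ℕ} (f : Fin n → Matrix (Fin 2) (Fin 2) ℂ) :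
    symmC (kron f) = ∑ k ∈ Finset.range n, kron (fun i => f (((finRotate n) ^ k) i)) := by
  rw [symmC]
  apply Finset.sum_congr rfl
  intro k _
  rw [Pk_kron, mul_assoc, Pk_inv, mul_one]

lemma symmC_smul {n : ℕ} (c : ℂ) (A : M n) : symmC (c • A) = c • symmC A := by
  simp [symmC, Finset.smul_sum]

lemma P_pauliAt {n : ℕ} (a : Matrix (Fin 2) (Fin 2) ℂ) (j : Fin n) :
    P n * pauliAt n a (finRotate n j) = pauliAt n a j * P n := by
  rw [pauliAt, P_kron]; simp [pauliAt]

lemma P_EE (N : ℕ) (q : ℤ) : P (N + 1) * EE N (q + 2) = EE N q * P (N + 1) := by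
  rcases Int.even_or_odd' q with ⟨j, rfl | rfl⟩
  · rw [show 2 * j + 2 = 2 * (j + 1) by ring, EE_even, EE_even, xs, xs, ← rot_site]
    rw [mul_smul_comm, P_pauliAt, smul_mul_assoc]
  · rw [show 2 * j + 1 + 2 = 2 * (j + 1) + 1 by ring, EE_odd, EE_odd, zs, zs, ← rot_site]
    simp only [mul_smul_comm, smul_mul_assoc]
    rw [← mul_assoc, P_pauliAt, mul_assoc, P_pauliAt, mul_assoc]

lemma P_TT (N : ℕ) (p : ℤ) (l : ℕ) :
    P (N + 1) * TT (EE N) (p + 2) l = TT (EE N) p l * P (N + 1) := by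
  induction l with
  | zero => simp [TT]
  | succ l ih =>
    rw [TT, TT, ← mul_assoc, ih, mul_assoc, mul_assoc, ← P_EE]; congr 3; ring

lemma Pk_TT (N : ℕ) (p : ℤ) (l k : ℕ) :
    P (N + 1) ^ k * TT (EE N) p l = TT (EE N) (p - 2 * k) l * P (N + 1) ^ k := by
  induction k with
  | zero => simp
  | succ k ih =>
    rw [pow_succ', mul_assoc, ih, ← mul_assoc,
      show p - 2 * (k : ℤ) = (p - 2 * ((k + 1 : ℕ) : ℤ)) + 2 by push_cast; ring, P_TT, mul_assoc]

lemma symmC_TT (N : ℕ) (hN : 2 ≤ N) (p : ℤ) (l : ℕ) :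
    symmC (TT (EE N) p l) = SS (N + 1) (EE N) p l := by
  have h := cyc N hN
  rw [symmC, SS, ← Finset.sum_range_reflect]
  have : SS (N + 1) (EE N) (p - 2 * N) l = SS (N + 1) (EE N) p l := by
    rw [← h.SS_per_nat (p - 2 * N) l N]; congr 1; ring
  rw [SS, SS] at this
  rw [← this]
  apply Finset.sum_congr rfl
  intro k hk
  rw [Finset.mem_range] at hk
  rw [Pk_TT, mul_assoc, Pk_inv, mul_one]
  congr 1
  omega

/-! ### Identification of strings -/

lemma str_x (n : ℕ) (a : Matrix (Fin 2) (Fin 2) ℂ) (m : ℕ) (hm : m + 1 < n) :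
    str n a sz m * pauliAt n sx ⟨m + 1, hm⟩ = (-Complex.I) • str n a sy m := by
  rw [str, pauliAt, kron_mul]
  apply kron_scale _ ⟨m + 1, hm⟩
  intro i
  simp only [Fin.ext_iff]
  split_ifs <;> first | omega | simp [sz_sx]

lemma str_zz (n : ℕ) (a : Matrix (Fin 2) (Fin 2) ℂ) (m : ℕ) (hm : m + 2 < n) :
    str n a sy m * (pauliAt n sz ⟨m + 1, by omega⟩ * pauliAt n sz ⟨m + 2, hm⟩)
      = (-Complex.I) • str n a sz (m + 1) := by
  rw [str, pauliAt, pauliAt, kron_mul, kron_mul]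
  apply kron_scale _ ⟨m + 1, by omega⟩
  intro i
  simp only [Fin.ext_iff]
  split_ifs <;> first | omega | simp [sy_sz]

lemma str_base (n : ℕ) (hn : 1 < n) :
    pauliAt n sx ⟨0, by omega⟩ * (pauliAt n sz ⟨0, by omega⟩ * pauliAt n sz ⟨1, hn⟩)
      = Complex.I • str n sy sz 0 := by
  rw [str, pauliAt, pauliAt, pauliAt, kron_mul, kron_mul]
  apply kron_scale _ ⟨0, by omega⟩
  intro i
  simp only [Fin.ext_iff]
  split_ifs <;> first | omega | simp [sx_sz]

lemma str_base' (n : ℕ) (hn : 1 < n) :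
    pauliAt n sz ⟨0, by omega⟩ * pauliAt n sz ⟨1, hn⟩ = str n sz sz 0 := by
  rw [str, pauliAt, pauliAt, kron_mul]
  congr 1
  ext1 i
  simp only [Fin.ext_iff]
  split_ifs <;> first | omega | simp

lemma str_wrap (N : ℕ) (hN : 1 ≤ N) :
    str (N + 1) sz sy (N - 1) * (pauliAt (N + 1) sz ⟨N, by omega⟩ * pauliAt (N + 1) sz ⟨0, by omega⟩)
      = (-Complex.I) • kron (fun i : Fin (N + 1) => if (i : ℕ) = 0 then 1 else sx) := by
  rw [str, pauliAt, pauliAt, kron_mul, kron_mul]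
  apply kron_scale _ ⟨N, by omega⟩
  intro i
  have := i.2
  simp only [Fin.ext_iff]
  split_ifs <;> first | omega | simp [sy_sz, sz_sz]

lemma EE_x (N m : ℕ) (h : m < N + 1) (q : ℤ) (hq : q = 2 * m) :
    EE N q = Complex.I • pauliAt (N + 1) sx ⟨m, h⟩ := by
  rw [hq, EE_even, site_val N m h]; rfl

lemma EE_z (N m : ℕ) (h : m + 1 < N + 1) (q : ℤ) (hq : q = 2 * m + 1) :
    EE N q = Complex.I • (pauliAt (N + 1) sz ⟨m, by omega⟩ * pauliAt (N + 1) sz ⟨m + 1, h⟩) := by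
  rw [hq, EE_odd, zs, rot_site, site_val N m (by omega), ← site_val N (m + 1) h]; rfl

lemma EE_last (N : ℕ) (q : ℤ) (hq : q = 2 * N + 1) :
    EE N q = Complex.I • (pauliAt (N + 1) sz ⟨N, by omega⟩ * pauliAt (N + 1) sz ⟨0, by omega⟩) := by
  rw [hq, EE_odd, zs, rot_site, site_val N N (by omega)]
  congr 3
  have := site_val N 0 (by omega)
  rw [← this, site_eq]
  exact ⟨-1, by push_cast; ring⟩

lemma I_I {n : ℕ} (A : M n) : Complex.I • (-Complex.I) • A = A := by
  rw [smul_smul]; simp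

lemma T1 (N : ℕ) (m : ℕ) (hm : m + 1 ≤ N) :
    TT (EE N) 1 (2 * m + 1) = Complex.I • str (N + 1) sz sz m ∧
    TT (EE N) 1 (2 * m + 2) = Complex.I • str (N + 1) sz sy m := by
  have step : ∀ m, m + 1 ≤ N → TT (EE N) 1 (2 * m + 1) = Complex.I • str (N + 1) sz sz m →
    TT (EE N) 1 (2 * m + 2) = Complex.I • str (N + 1) sz sy m := by
    intro m hm h
    rw [TT, h, EE_x N (m + 1) (by omega) _ (by push_cast; ring), smul_mul_smul_comm, str_x,
      ← smul_smul, I_I]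
  have main : TT (EE N) 1 (2 * m + 1) = Complex.I • str (N + 1) sz sz m := by
    induction m with
    | zero =>
      rw [mul_zero, zero_add, TT_one, EE_z N 0 (by omega) _ (by simp), str_base']
    | succ m ih =>
      have h := step m (by omega) (ih (by omega))
      rw [show 2 * (m + 1) + 1 = 2 * m + 2 + 1 by ring, TT, h,
        EE_z N (m + 1) (by omega) _ (by push_cast; ring), smul_mul_smul_comm, str_zz,
        ← smul_smul, I_I]
  exact ⟨main, step m hm main⟩

lemma T0 (N : ℕ) (m : ℕ) (hm : m + 1 ≤ N) :
    TT (EE N) 0 (2 * m + 2) = (-Complex.I) • str (N + 1) sy sz m ∧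
    TT (EE N) 0 (2 * m + 3) = (-Complex.I) • str (N + 1) sy sy m := by
  have II : ∀ A : M (N + 1), (-Complex.I * Complex.I) • (-Complex.I) • A = (-Complex.I) • A := by
    intro A; simp
  have step : ∀ m, m + 1 ≤ N → TT (EE N) 0 (2 * m + 2) = (-Complex.I) • str (N + 1) sy sz m →
    TT (EE N) 0 (2 * m + 3) = (-Complex.I) • str (N + 1) sy sy m := by
    intro m hm h
    rw [TT, h, EE_x N (m + 1) (by omega) _ (by push_cast; ring), smul_mul_smul_comm, str_x, II]
  have main : TT (EE N) 0 (2 * m + 2) = (-Complex.I) • str (N + 1) sy sz m := by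
    induction m with
    | zero =>
      rw [mul_zero, zero_add, TT, TT_one, EE_x N 0 (by omega) 0 (by simp),
        EE_z N 0 (by omega) _ (by simp), smul_mul_smul_comm, str_base]; simp
    | succ m ih =>
      have h := step m (by omega) (ih (by omega))
      rw [show 2 * (m + 1) + 2 = 2 * m + 3 + 1 by ring, TT, h,
        EE_z N (m + 1) (by omega) _ (by push_cast; ring), smul_mul_smul_comm, str_zz, II]
  exact ⟨main, step m hm main⟩

lemma Y_eq (N : ℕ) (hN : 2 ≤ N) (m : ℕ) (hm : m + 1 ≤ N) :
    Y (N + 1) m = -SS (N + 1) (EE N) 0 (2 * m + 3) := by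
  rw [← symmC_TT N hN, (T0 N m hm).2, symmC_smul, neg_smul, neg_neg, Y]

lemma Z_eq (N : ℕ) (hN : 2 ≤ N) (m : ℕ) (hm : m + 1 ≤ N) :
    Z (N + 1) m = SS (N + 1) (EE N) 1 (2 * m + 1) := by
  rw [← symmC_TT N hN, (T1 N m hm).1, symmC_smul, Z]

lemma YZ_eq (N : ℕ) (hN : 2 ≤ N) (m : ℕ) (hm : m + 1 ≤ N) :
    YZ (N + 1) m = -(SS (N + 1) (EE N) 0 (2 * m + 2) - SS (N + 1) (EE N) 1 (2 * m + 2)) := by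
  rw [← symmC_TT N hN, ← symmC_TT N hN, (T1 N m hm).2, (T0 N m hm).1, symmC_smul, symmC_smul, YZ,
    neg_smul]
  abel

lemma X_eq (N : ℕ) (hN : 2 ≤ N) : X (N + 1) = SS (N + 1) (EE N) 0 1 := by
  rw [← symmC_TT N hN, TT_one, EE_x N 0 (by omega) _ (by simp), symmC_smul, X, pauliAt]
  simp only [Fin.ext_iff]

lemma T1_last (N : ℕ) (hN : 1 ≤ N) : TT (EE N) 1 (2 * N + 1) =
    Complex.I • kron (fun i : Fin (N + 1) => if (i : ℕ) = 0 then 1 else sx) := by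
  have h := (T1 N (N - 1) (by omega)).2
  rw [show 2 * (N - 1) + 2 = 2 * N by omega] at h
  rw [TT, h, EE_last N _ (by push_cast; ring), smul_mul_smul_comm, str_wrap N hN, ← smul_smul, I_I]

lemma XX_eq (N : ℕ) (hN : 2 ≤ N) : XX (N + 1) = SS (N + 1) (EE N) 1 (2 * N + 1) := by
  have h := cyc N hN
  rw [← h.SS_neg, ← symmC_TT N hN, XX, ← symmC_smul]
  congr 1
  have h1 := P_TT N (-1) (2 * N + 1)
  rw [show (-1 : ℤ) + 2 = 1 by norm_num, T1_last N (by omega), mul_smul_comm, P_kron,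
    ← smul_mul_assoc] at h1
  rw [← (P_unit (N + 1)).mul_left_inj, ← h1]
  congr 4
  ext1 i
  have e : ((finRotate (N + 1) i : Fin (N + 1)) : ℕ) = 0 ↔ (i : ℕ) = N := by
    have := i.2
    rw [coe_finRotate]
    split_ifs with hi
    · simp [hi]
    · simp only [Nat.succ_ne_zero, false_iff]
      intro h'; apply hi; ext; simpa using h'
  simp only [e, Nat.add_sub_cancel]

lemma H1_eq (N : ℕ) : Complex.I • H1 (N + 1) = SS (N + 1) (EE N) 0 1 := by
  rw [H1, SS, Finset.smul_sum, Finset.sum_range]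
  apply Finset.sum_congr rfl
  intro j _
  rw [TT_one, EE_x N j j.2 _ (by simp)]

lemma H0_eq (N : ℕ) : Complex.I • H0 (N + 1) = SS (N + 1) (EE N) 1 1 := by
  rw [H0, SS, Finset.smul_sum, Finset.sum_range]
  apply Finset.sum_congr rfl
  intro j _
  rw [TT_one, add_comm (1 : ℤ), EE_odd, zs, site_val N j j.2]

/-! ### The Lie algebra -/

def GG (n : ℕ) : Set (M n) :=
  (Set.range fun j : Fin (n - 1) => Y n (j : ℕ)) ∪
       (Set.range fun j : Fin (n - 1) => Z n (j : ℕ)) ∪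
       (Set.range fun j : Fin (n - 1) => YZ n (j : ℕ)) ∪
       {X n, XX n}

section lie

lemma lie_br {n : ℕ} (x y : M n) : ⁅x, y⁆ = br x y := rfl

lemma two_mul_real {n : ℕ} (x : M n) : 2 * x = (2 : ℝ) • x := by
  rw [two_mul, two_smul]

lemma neg_two_mul_real {n : ℕ} (x : M n) : -2 * x = (-2 : ℝ) • x := by
  rw [neg_mul, two_mul_real, neg_smul]

lemma mem_o0 (N : ℕ) (hN : 2 ≤ N) (m : ℕ) (hm : m ≤ N) :
    SS (N + 1) (EE N) 0 (2 * m + 1) ∈ Submodule.span ℝ (GG (N + 1)) := by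
  rcases m with _ | m
  · rw [mul_zero, zero_add, ← X_eq N hN]
    exact Submodule.subset_span (by simp [GG])
  · have h := Y_eq N hN m hm
    rw [show 2 * (m + 1) + 1 = 2 * m + 3 by ring, ← neg_neg (SS _ _ _ _), ← h]
    refine Submodule.neg_mem _ (Submodule.subset_span ?_)
    exact Or.inl (Or.inl (Or.inl ⟨⟨m, by omega⟩, rfl⟩))

lemma mem_o1 (N : ℕ) (hN : 2 ≤ N) (m : ℕ) (hm : m ≤ N) :
    SS (N + 1) (EE N) 1 (2 * m + 1) ∈ Submodule.span ℝ (GG (N + 1)) := by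
  by_cases h : m = N
  · rw [h, ← XX_eq N hN]
    exact Submodule.subset_span (by simp [GG])
  · rw [← Z_eq N hN m (by omega)]
    refine Submodule.subset_span ?_
    exact Or.inl (Or.inl (Or.inr ⟨⟨m, by omega⟩, rfl⟩))

lemma mem_g (N : ℕ) (hN : 2 ≤ N) (m : ℕ) (hm : m + 1 ≤ N) :
    SS (N + 1) (EE N) 0 (2 * m + 2) - SS (N + 1) (EE N) 1 (2 * m + 2)
      ∈ Submodule.span ℝ (GG (N + 1)) := by
  rw [← neg_neg (_ - _), ← YZ_eq N hN m hm]
  refine Submodule.neg_mem _ (Submodule.subset_span ?_)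
  exact Or.inl (Or.inr ⟨⟨m, by omega⟩, rfl⟩)

lemma SS_two (N : ℕ) (hN : 2 ≤ N) (l : ℕ) : SS (N + 1) (EE N) (1 + 1) l = SS (N + 1) (EE N) 0 l := by
  have := (cyc N hN).SS_per 0 l
  rw [← this]; rfl

lemma SS_zero (N : ℕ) (p : ℤ) : SS (N + 1) (EE N) p 0 = SS (N + 1) (EE N) 0 0 := by
  simp [SS, TT]

/-- brackets with the two generators, in the basis -/
lemma br_a_o0 (N : ℕ) (hN : 2 ≤ N) (m : ℕ) (hm : m ≤ N) : br (SS (N + 1) (EE N) 0 1) (SS (N + 1) (EE N) 0 (2 * m + 1))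
    = (2 : ℝ) • (SS (N + 1) (EE N) 0 (2 * m) - SS (N + 1) (EE N) 1 (2 * m)) := by
  rw [(cyc N hN).B1 0 m (by omega), two_mul_real]; rfl

lemma br_b_o1 (N : ℕ) (hN : 2 ≤ N) (m : ℕ) (hm : m ≤ N) : br (SS (N + 1) (EE N) 1 1) (SS (N + 1) (EE N) 1 (2 * m + 1))
    = (-2 : ℝ) • (SS (N + 1) (EE N) 0 (2 * m) - SS (N + 1) (EE N) 1 (2 * m)) := by
  rw [(cyc N hN).B1 1 m (by omega), two_mul_real, SS_two N hN, neg_smul, ← smul_neg, neg_sub]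

lemma br_b_o0 (N : ℕ) (hN : 2 ≤ N) (m : ℕ) (hm : m + 1 ≤ N) :
    br (SS (N + 1) (EE N) 1 1) (SS (N + 1) (EE N) 0 (2 * m + 1))
    = (-2 : ℝ) • (SS (N + 1) (EE N) 0 (2 * m + 2) - SS (N + 1) (EE N) 1 (2 * m + 2)) := by
  have := (cyc N hN).B2 0 m (by omega)
  rw [zero_add] at this
  rw [this, two_mul_real, neg_smul, ← smul_neg, neg_sub]

lemma br_a_o1 (N : ℕ) (hN : 2 ≤ N) (m : ℕ) (hm : m + 1 ≤ N) :
    br (SS (N + 1) (EE N) 0 1) (SS (N + 1) (EE N) 1 (2 * m + 1))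
    = (2 : ℝ) • (SS (N + 1) (EE N) 0 (2 * m + 2) - SS (N + 1) (EE N) 1 (2 * m + 2)) := by
  have := (cyc N hN).B2 1 m (by omega)
  rw [SS_two N hN, SS_two N hN] at this
  rw [this, two_mul_real]

lemma br_a_g (N : ℕ) (hN : 2 ≤ N) (m : ℕ) (hm : m + 1 ≤ N) : br (SS (N + 1) (EE N) 0 1)
    (SS (N + 1) (EE N) 0 (2 * m + 2) - SS (N + 1) (EE N) 1 (2 * m + 2))
    = (-4 : ℝ) • (SS (N + 1) (EE N) 1 (2 * m + 1) + SS (N + 1) (EE N) 0 (2 * m + 3)) := by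
  have h1 := (cyc N hN).B3 0 m (by omega)
  have h2 := (cyc N hN).B4 1 m (by omega)
  rw [SS_two N hN, SS_two N hN, two_mul_real] at h2
  rw [zero_add, neg_two_mul_real] at h1
  have : ∀ x y z : M (N + 1), br x (y - z) = br x y - br x z := by
    intro x y z; simp only [br]; noncomm_ring
  rw [this, h1, h2]; module

lemma br_b_g (N : ℕ) (hN : 2 ≤ N) (m : ℕ) (hm : m + 1 ≤ N) : br (SS (N + 1) (EE N) 1 1)
    (SS (N + 1) (EE N) 0 (2 * m + 2) - SS (N + 1) (EE N) 1 (2 * m + 2))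
    = (4 : ℝ) • (SS (N + 1) (EE N) 0 (2 * m + 1) + SS (N + 1) (EE N) 1 (2 * m + 3)) := by
  have h1 := (cyc N hN).B3 1 m (by omega)
  have h2 := (cyc N hN).B4 0 m (by omega)
  rw [zero_add, two_mul_real] at h2
  rw [SS_two N hN, neg_two_mul_real] at h1
  have : ∀ x y z : M (N + 1), br x (y - z) = br x y - br x z := by
    intro x y z; simp only [br]; noncomm_ring
  rw [this, h1, h2]; module

lemma stab_o0 (N : ℕ) (hN : 2 ≤ N) (m : ℕ) (hm : m ≤ N) :
    br (SS (N + 1) (EE N) 0 1) (SS (N + 1) (EE N) 0 (2 * m + 1)) ∈ Submodule.span ℝ (GG (N + 1)) ∧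
    br (SS (N + 1) (EE N) 1 1) (SS (N + 1) (EE N) 0 (2 * m + 1)) ∈ Submodule.span ℝ (GG (N + 1)) := by
  constructor
  · rw [br_a_o0 N hN m hm]
    refine Submodule.smul_mem _ _ ?_
    rcases m with _ | m
    · rw [mul_zero, SS_zero N 1, sub_self]; exact Submodule.zero_mem _
    · exact mem_g N hN m hm
  · by_cases h : m = N
    · have := (cyc N hN).B2' 0 m (by omega) (by omega)
      rw [zero_add] at this
      rw [this]; exact Submodule.zero_mem _
    · rw [br_b_o0 N hN m (by omega)]
      exact Submodule.smul_mem _ _ (mem_g N hN m (by omega))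

lemma stab_o1 (N : ℕ) (hN : 2 ≤ N) (m : ℕ) (hm : m ≤ N) :
    br (SS (N + 1) (EE N) 0 1) (SS (N + 1) (EE N) 1 (2 * m + 1)) ∈ Submodule.span ℝ (GG (N + 1)) ∧
    br (SS (N + 1) (EE N) 1 1) (SS (N + 1) (EE N) 1 (2 * m + 1)) ∈ Submodule.span ℝ (GG (N + 1)) := by
  constructor
  · by_cases h : m = N
    · have := (cyc N hN).B2' 1 m (by omega) (by omega)
      rw [SS_two N hN] at this
      rw [this]; exact Submodule.zero_mem _
    · rw [br_a_o1 N hN m (by omega)]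
      exact Submodule.smul_mem _ _ (mem_g N hN m (by omega))
  · rw [br_b_o1 N hN m hm]
    refine Submodule.smul_mem _ _ ?_
    rcases m with _ | m
    · rw [mul_zero, SS_zero N 1, sub_self]; exact Submodule.zero_mem _
    · exact mem_g N hN m hm

lemma stab_g (N : ℕ) (hN : 2 ≤ N) (m : ℕ) (hm : m + 1 ≤ N) :
    br (SS (N + 1) (EE N) 0 1) (SS (N + 1) (EE N) 0 (2 * m + 2) - SS (N + 1) (EE N) 1 (2 * m + 2))
      ∈ Submodule.span ℝ (GG (N + 1)) ∧
    br (SS (N + 1) (EE N) 1 1) (SS (N + 1) (EE N) 0 (2 * m + 2) - SS (N + 1) (EE N) 1 (2 * m + 2))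
      ∈ Submodule.span ℝ (GG (N + 1)) := by
  rw [br_a_g N hN m hm, br_b_g N hN m hm]
  exact ⟨Submodule.smul_mem _ _ (Submodule.add_mem _ (mem_o1 N hN m (by omega))
      (mem_o0 N hN (m + 1) (by omega))),
    Submodule.smul_mem _ _ (Submodule.add_mem _ (mem_o0 N hN m (by omega))
      (mem_o1 N hN (m + 1) (by omega)))⟩

lemma stab (N : ℕ) (hN : 2 ≤ N) (v : M (N + 1)) (hv : v ∈ Submodule.span ℝ (GG (N + 1))) :
    ⁅SS (N + 1) (EE N) 0 1, v⁆ ∈ Submodule.span ℝ (GG (N + 1)) ∧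
    ⁅SS (N + 1) (EE N) 1 1, v⁆ ∈ Submodule.span ℝ (GG (N + 1)) := by
  induction hv using Submodule.span_induction with
  | mem x hx =>
    rcases hx with ((⟨j, rfl⟩ | ⟨j, rfl⟩) | ⟨j, rfl⟩) | hx
    · have hj : (j : ℕ) + 1 ≤ N := by have := j.2; omega
      have := stab_o0 N hN (j + 1) hj
      simp only [Y_eq N hN j hj, lie_neg]
      exact ⟨Submodule.neg_mem _ this.1, Submodule.neg_mem _ this.2⟩
    · have hj : (j : ℕ) + 1 ≤ N := by have := j.2; omega
      have := stab_o1 N hN j (by omega)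
      simp only [Z_eq N hN j hj]
      exact this
    · have hj : (j : ℕ) + 1 ≤ N := by have := j.2; omega
      have := stab_g N hN j hj
      simp only [YZ_eq N hN j hj]
      rw [lie_neg, lie_neg]
      exact ⟨Submodule.neg_mem _ this.1, Submodule.neg_mem _ this.2⟩
    · rcases hx with hx | hx
      · rw [hx, X_eq N hN]; exact stab_o0 N hN 0 (by omega)
      · rw [Set.mem_singleton_iff] at hx
        rw [hx, XX_eq N hN]; exact stab_o1 N hN N le_rfl
  | zero => simp
  | add x y _ _ hx hy =>
    rw [lie_add, lie_add]
    exact ⟨Submodule.add_mem _ hx.1 hy.1, Submodule.add_mem _ hx.2 hy.2⟩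
  | smul c x _ hx =>
    rw [lie_smul, lie_smul]
    exact ⟨Submodule.smul_mem _ _ hx.1, Submodule.smul_mem _ _ hx.2⟩

lemma DLA_le (N : ℕ) (hN : 2 ≤ N) (x : M (N + 1)) (hx : x ∈ DLA (N + 1)) :
    x ∈ Submodule.span ℝ (GG (N + 1)) ∧
    ∀ v ∈ Submodule.span ℝ (GG (N + 1)), ⁅x, v⁆ ∈ Submodule.span ℝ (GG (N + 1)) := by
  rw [DLA, H0_eq, H1_eq] at hx
  induction hx using LieSubalgebra.lieSpan_induction with
  | mem x hx =>
    rcases hx with hx | hx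
    · rw [hx]
      exact ⟨mem_o1 N hN 0 (by omega), fun v hv => (stab N hN v hv).2⟩
    · rw [Set.mem_singleton_iff] at hx
      rw [hx]
      exact ⟨mem_o0 N hN 0 (by omega), fun v hv => (stab N hN v hv).1⟩
  | zero => exact ⟨Submodule.zero_mem _, fun v hv => by rw [zero_lie]; exact Submodule.zero_mem _⟩
  | add x y _ _ hx hy =>
    exact ⟨Submodule.add_mem _ hx.1 hy.1, fun v hv => by
      rw [add_lie]; exact Submodule.add_mem _ (hx.2 v hv) (hy.2 v hv)⟩
  | smul c x _ hx =>
    exact ⟨Submodule.smul_mem _ _ hx.1, fun v hv => by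
      rw [smul_lie]; exact Submodule.smul_mem _ _ (hx.2 v hv)⟩
  | lie x y _ _ hx hy =>
    refine ⟨hx.2 y hy.1, fun v hv => ?_⟩
    rw [lie_lie]
    exact Submodule.sub_mem _ (hx.2 _ (hy.2 v hv)) (hy.2 _ (hx.2 v hv))

lemma gen_a (N : ℕ) : SS (N + 1) (EE N) 0 1 ∈ DLA (N + 1) := by
  rw [DLA, H0_eq, H1_eq]; exact LieSubalgebra.subset_lieSpan (by simp)

lemma gen_b (N : ℕ) : SS (N + 1) (EE N) 1 1 ∈ DLA (N + 1) := by
  rw [DLA, H0_eq, H1_eq]; exact LieSubalgebra.subset_lieSpan (by simp)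

lemma gen_g (N : ℕ) (hN : 2 ≤ N) (m : ℕ) (hm : m + 1 ≤ N) (h : SS (N + 1) (EE N) 1 (2 * m + 1) ∈ DLA (N + 1)) :
    SS (N + 1) (EE N) 0 (2 * m + 2) - SS (N + 1) (EE N) 1 (2 * m + 2) ∈ DLA (N + 1) := by
  have h1 := LieSubalgebra.lie_mem _ (gen_a N) h
  rw [lie_br, br_a_o1 N hN m hm] at h1
  have := LieSubalgebra.smul_mem _ (2⁻¹ : ℝ) h1
  rwa [smul_smul, inv_mul_cancel₀ (by norm_num), one_smul] at this

lemma gen_o (N : ℕ) (hN : 2 ≤ N) (m : ℕ) (hm : m ≤ N) : SS (N + 1) (EE N) 0 (2 * m + 1) ∈ DLA (N + 1) ∧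
    SS (N + 1) (EE N) 1 (2 * m + 1) ∈ DLA (N + 1) := by
  induction m with
  | zero => exact ⟨gen_a N, gen_b N⟩
  | succ m ih =>
    obtain ⟨h0, h1⟩ := ih (by omega)
    have hg := gen_g N hN m hm h1
    have ha := LieSubalgebra.lie_mem _ (gen_a N) hg
    have hb := LieSubalgebra.lie_mem _ (gen_b N) hg
    rw [lie_br, br_a_g N hN m hm] at ha
    rw [lie_br, br_b_g N hN m hm] at hb
    constructor
    · have := LieSubalgebra.sub_mem _ (LieSubalgebra.smul_mem _ ((-4)⁻¹ : ℝ) ha) h1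
      rwa [smul_smul, inv_mul_cancel₀ (by norm_num), one_smul, add_sub_cancel_left] at this
    · have := LieSubalgebra.sub_mem _ (LieSubalgebra.smul_mem _ ((4)⁻¹ : ℝ) hb) h0
      rwa [smul_smul, inv_mul_cancel₀ (by norm_num), one_smul, add_sub_cancel_left] at this

lemma DLA_eq (N : ℕ) (hN : 2 ≤ N) : (DLA (N + 1)).toSubmodule = Submodule.span ℝ (GG (N + 1)) := by
  apply le_antisymm
  · intro x hx
    exact (DLA_le N hN x hx).1
  · rw [Submodule.span_le]
    intro x hx
    show x ∈ DLA (N + 1)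
    rcases hx with ((⟨j, rfl⟩ | ⟨j, rfl⟩) | ⟨j, rfl⟩) | hx
    · have hj : (j : ℕ) + 1 ≤ N := by have := j.2; omega
      simp only [Y_eq N hN j hj]
      exact (DLA (N + 1)).toSubmodule.neg_mem (gen_o N hN (j + 1) hj).1
    · have hj : (j : ℕ) + 1 ≤ N := by have := j.2; omega
      simp only [Z_eq N hN j hj]
      exact (gen_o N hN j (by omega)).2
    · have hj : (j : ℕ) + 1 ≤ N := by have := j.2; omega
      simp only [YZ_eq N hN j hj]
      exact (DLA (N + 1)).toSubmodule.neg_mem (gen_g N hN j hj (gen_o N hN j (by omega)).2)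
    · rcases hx with hx | hx
      · rw [hx, X_eq N hN]; exact gen_a N
      · rw [Set.mem_singleton_iff] at hx
        rw [hx, XX_eq N hN]; exact (gen_o N hN N le_rfl).2

end lie

/-! ### Linear independence -/

def pw : Fin 4 → Matrix (Fin 2) (Fin 2) ℂ := ![1, sx, sy, sz]

lemma tr_pw (a b : Fin 4) : Matrix.trace (pw a * pw b) = if a = b then 2 else 0 := by
  fin_cases a <;> fin_cases b <;>
    simp [pw, sx, sy, sz, Matrix.trace, Fin.sum_univ_two, Matrix.one_apply] <;> norm_num

def kw {n : ℕ} (w : Fin n → Fin 4) : M n := kron fun i => pw (w i)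

lemma tr_kron {n : ℕ} (f : Fin n → Matrix (Fin 2) (Fin 2) ℂ) :
    Matrix.trace (kron f) = ∏ i, Matrix.trace (f i) := by
  simp only [Matrix.trace, Matrix.diag_apply, kron, Finset.prod_univ_sum, Fintype.piFinset_univ]

lemma tr_kw {n : ℕ} (w u : Fin n → Fin 4) :
    Matrix.trace (kw w * kw u) = if w = u then 2 ^ n else 0 := by
  rw [kw, kw, kron_mul, tr_kron]
  simp only [tr_pw, Finset.prod_ite_zero, Finset.mem_univ, forall_true_left, Finset.prod_const,
    Finset.card_univ, Fintype.card_fin, funext_iff]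

def wt (n : ℕ) : Fin 4 → ℕ := ![0, 1, n, n * n]

def WW {n : ℕ} (w : Fin n → Fin 4) : ℕ := ∑ i, wt n (w i)

def phi (n : ℕ) (c : ℕ) : M n →ₗ[ℝ] ℂ :=
  ∑ w ∈ Finset.univ.filter (fun w : Fin n → Fin 4 => WW w = c),
    ((Matrix.traceLinearMap (Fin n → Fin 2) ℝ ℂ) ∘ₗ (LinearMap.mulLeft ℝ (kw w)))

lemma phi_kw {n : ℕ} (c : ℕ) (u : Fin n → Fin 4) (d : ℂ) :
    phi n c (d • kw u) = if WW u = c then d * 2 ^ n else 0 := by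
  simp only [phi, LinearMap.sum_apply, LinearMap.comp_apply, LinearMap.mulLeft_apply,
    Matrix.traceLinearMap_apply, mul_smul_comm, Matrix.trace_smul, tr_kw, smul_eq_mul]
  simp [Finset.sum_filter]

lemma phi_symm {n : ℕ} (c : ℕ) (u : Fin n → Fin 4) :
    phi n c (Complex.I • symmC (kw u)) = if WW u = c then n * (Complex.I * 2 ^ n) else 0 := by
  have h : ∀ k, (kron fun i => pw (u (((finRotate n) ^ k) i))) =
    kw (fun i => u (((finRotate n) ^ k) i)) := fun k => rfl
  have hW : ∀ k, WW (fun i => u (((finRotate n) ^ k) i)) = WW u := by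
    intro k
    exact Equiv.sum_comp ((finRotate n) ^ k) (fun i => wt n (u i))
  rw [kw, symmC_kron, Finset.smul_sum, map_sum]
  simp only [h, phi_kw, hW]
  split_ifs <;> simp

def wstr (n : ℕ) (a b : Fin 4) (j : ℕ) : Fin n → Fin 4 := fun i =>
  if (i : ℕ) = 0 then a else if (i : ℕ) = j + 1 then b else if (i : ℕ) ≤ j then 1 else 0

lemma str_kw (n : ℕ) (a b : Fin 4) (j : ℕ) : str n (pw a) (pw b) j = kw (wstr n a b j) := by
  rw [str, kw]; congr 1; ext1 i; rw [wstr]; split_ifs <;> rfl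

lemma WW_wstr (n : ℕ) (a b : Fin 4) (j : ℕ) (hj : j + 1 < n) :
    WW (wstr n a b j) = wt n a + wt n b + j := by
  have h : ∀ i : Fin n, wt n (wstr n a b j i) = (if (i : ℕ) = 0 then wt n a else 0)
      + (if (i : ℕ) = j + 1 then wt n b else 0)
      + (if (i : ℕ) ∈ Finset.Icc 1 j then 1 else 0) := by
    intro i
    simp only [wstr, Finset.mem_Icc]
    split_ifs <;> first | omega | simp [wt]
  simp only [WW, h]
  rw [Fin.sum_univ_eq_sum_range (fun i => (if i = 0 then wt n a else 0)
      + (if i = j + 1 then wt n b else 0) + (if i ∈ Finset.Icc 1 j then 1 else 0)) n]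
  rw [Finset.sum_add_distrib, Finset.sum_add_distrib, Finset.sum_ite_eq', Finset.sum_ite_eq',
    if_pos (by simp; omega), if_pos (by simp; omega), ← Finset.sum_filter, Finset.filter_mem_eq_inter,
    Finset.inter_eq_right.2 (by intro x; simp; omega)]
  simp

def wX (n : ℕ) : Fin n → Fin 4 := fun i => if (i : ℕ) = 0 then 1 else 0
def wXX (n : ℕ) : Fin n → Fin 4 := fun i => if (i : ℕ) = n - 1 then 0 else 1

lemma WW_wX (N : ℕ) : WW (wX (N + 1)) = 1 := by
  simp [WW, wX, Fin.sum_univ_succ, wt]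

lemma WW_wXX (N : ℕ) : WW (wXX (N + 1)) = N := by
  rw [WW, Fin.sum_univ_castSucc]
  have : ∀ i : Fin N, wt (N + 1) (wXX (N + 1) i.castSucc) = 1 := by
    intro i
    have := i.2
    rw [wXX, if_neg (by simp; omega)]; rfl
  simp only [this]
  simp [wXX, wt]

lemma X_kw (n : ℕ) : X n = Complex.I • symmC (kw (wX n)) := by
  rw [X, kw]; congr 3; ext1 i; rw [wX]; split_ifs <;> rfl

lemma XX_kw (n : ℕ) : XX n = Complex.I • symmC (kw (wXX n)) := by
  rw [XX, kw]; congr 3; ext1 i; rw [wXX]; split_ifs <;> rfl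

abbrev Idx (N : ℕ) := ((Fin N ⊕ Fin N) ⊕ Fin N) ⊕ Fin 2

def fam (N : ℕ) : Idx N → M (N + 1) :=
  Sum.elim (Sum.elim (Sum.elim (fun j => Y (N + 1) j) (fun j => Z (N + 1) j))
    (fun j => YZ (N + 1) j)) ![X (N + 1), XX (N + 1)]

def cod (N : ℕ) : Idx N → ℕ :=
  Sum.elim (Sum.elim (Sum.elim (fun j => 2 * (N + 1) + j) (fun j => 2 * ((N + 1) * (N + 1)) + j))
    (fun j => (N + 1) + (N + 1) * (N + 1) + j)) ![1, N]

lemma cod_inj (N : ℕ) (hN : 2 ≤ N) : Function.Injective (cod N) := by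
  have h : 3 * (N + 1) ≤ (N + 1) * (N + 1) := by nlinarith
  generalize hs : (N + 1) * (N + 1) = s at h
  intro a b hab
  rcases a with ((⟨a, ha⟩ | ⟨a, ha⟩) | ⟨a, ha⟩) | a <;>
  rcases b with ((⟨b, hb⟩ | ⟨b, hb⟩) | ⟨b, hb⟩) | b <;>
  try fin_cases a
  all_goals try fin_cases b
  all_goals simp [cod, hs] at hab ⊢
  all_goals omega

lemma phi_fam (N : ℕ) (c : ℕ) (t : Idx N) :
    ∃ d : ℂ, d ≠ 0 ∧ phi (N + 1) c (fam N t) = if cod N t = c then d else 0 := by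
  have hd : ((N + 1 : ℕ) : ℂ) * (Complex.I * 2 ^ (N + 1)) ≠ 0 := by
    refine mul_ne_zero (by exact_mod_cast Nat.succ_ne_zero N) (mul_ne_zero Complex.I_ne_zero ?_)
    exact pow_ne_zero _ (by norm_num)
  rcases t with ((j | j) | j) | t
  · refine ⟨_, hd, ?_⟩
    show phi (N + 1) c (Complex.I • symmC (str (N + 1) (pw 2) (pw 2) j)) = _
    rw [str_kw, phi_symm, WW_wstr _ _ _ _ (by have := j.2; omega)]
    congr 2
    simp [wt, cod]; ring
  · refine ⟨_, hd, ?_⟩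
    show phi (N + 1) c (Complex.I • symmC (str (N + 1) (pw 3) (pw 3) j)) = _
    rw [str_kw, phi_symm, WW_wstr _ _ _ _ (by have := j.2; omega)]
    congr 2
    simp [wt, cod]; ring
  · refine ⟨2 * _, mul_ne_zero two_ne_zero hd, ?_⟩
    show phi (N + 1) c (Complex.I • symmC (str (N + 1) (pw 3) (pw 2) j)
      + Complex.I • symmC (str (N + 1) (pw 2) (pw 3) j)) = _
    rw [map_add, str_kw, phi_symm, str_kw, phi_symm, WW_wstr _ _ _ _ (by have := j.2; omega),
      WW_wstr _ _ _ _ (by have := j.2; omega)]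
    have e1 : wt (N + 1) 3 + wt (N + 1) 2 + (j : ℕ) = cod N (Sum.inl (Sum.inr j)) := by
      simp [wt, cod]; ring
    have e2 : wt (N + 1) 2 + wt (N + 1) 3 + (j : ℕ) = cod N (Sum.inl (Sum.inr j)) := by
      simp [wt, cod]
    rw [e1, e2]
    split_ifs
    · ring
    · simp
  · refine ⟨_, hd, ?_⟩
    fin_cases t
    · show phi (N + 1) c (X (N + 1)) = _
      rw [X_kw, phi_symm, WW_wX]; rfl
    · show phi (N + 1) c (XX (N + 1)) = _
      rw [XX_kw, phi_symm, WW_wXX]; rfl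

lemma fam_indep (N : ℕ) (hN : 2 ≤ N) : LinearIndependent ℝ (fam N) := by
  rw [Fintype.linearIndependent_iff]
  intro g hg t
  have h := congrArg (phi (N + 1) (cod N t)) hg
  rw [map_sum, map_zero, Finset.sum_eq_single t] at h
  · obtain ⟨d, hd, e⟩ := phi_fam N (cod N t) t
    rw [map_smul, e, if_pos rfl] at h
    exact (smul_eq_zero.1 h).resolve_right hd
  · intro s _ hs
    obtain ⟨d, hd, e⟩ := phi_fam N (cod N t) s
    rw [map_smul, e, if_neg (fun h' => hs (cod_inj N hN h')), smul_zero]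
  · simp

lemma range_fam (N : ℕ) : Set.range (fam N) = GG (N + 1) := by
  rw [fam, Set.Sum.elim_range, Set.Sum.elim_range, Set.Sum.elim_range, Matrix.range_cons,
    Matrix.range_cons, Matrix.range_empty, GG, Set.union_empty]
  rfl

/-- For every `n ≥ 3`, the dynamical Lie algebra equals the real
linear span of the `3n-1` matrices `Y^j, Z^j, YZ^j` (`j = 0, …, n-2`), `X`, `XX`;
in particular it has real dimension `3n - 1`. -/
theorem stmt0 (n : ℕ) (hn : 3 ≤ n) :
    (DLA n).toSubmodule = Submodule.span ℝ
      ((Set.range fun j : Fin (n - 1) => Y n (j : ℕ)) ∪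
       (Set.range fun j : Fin (n - 1) => Z n (j : ℕ)) ∪
       (Set.range fun j : Fin (n - 1) => YZ n (j : ℕ)) ∪
       {X n, XX n}) ∧
    Module.finrank ℝ (DLA n) = 3 * n - 1 := by
  obtain ⟨N, rfl⟩ : ∃ N, n = N + 1 := ⟨n - 1, by omega⟩
  have hN : 2 ≤ N := by omega
  have h := DLA_eq N hN
  refine ⟨h, ?_⟩
  show Module.finrank ℝ (DLA (N + 1)).toSubmodule = _
  rw [h, ← range_fam, finrank_span_eq_card (fam_indep N hN)]
  simp
  omega

end
end Ising
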